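/- Proposition 3 (EUKF-C specializes to the Kalman filter for linear systems): with B·Bᵀ = n·P, the EUKF-C gain K^EUKFC := P_ez^EUKFC·(P_z^EUKFC)⁻¹ equals the Kalman gain K_KF = P_prior·Cᵀ·R̄⁻¹, and the EUKF-C posterior covariance P_prior^EUKFC − P_ez^EUKFC·(P_z^EUKFC)⁻¹·(P_ez^EUKFC)ᵀ equals the Kalman posterior covariance P_prior − P_prior·Cᵀ·R̄⁻¹·C·P_prior. -/

import Mathlib

open Matrix

/-- UKF weight vector `W ∈ ℝ^{2n+1}`. -/
noncomputable def ukfW (n : ℕ) (α : ℝ) : Fin (2*n+1) → ℝ :=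
  fun i => if i.val = 0 then (α^2 - 1)/α^2 else 1/(2*α^2*n)

/-- Perturbation matrix `Δ(α, B)`: first column 0, next n columns `α·bᵢ`,
last n columns `−α·bᵢ`. -/
noncomputable def ukfDelta (n : ℕ) (α : ℝ) (B : Matrix (Fin n) (Fin n) ℝ) :
    Matrix (Fin n) (Fin (2*n+1)) ℝ :=
  Matrix.of fun i j =>
    if h0 : j.val = 0 then 0
    else if h1 : j.val ≤ n then α * B i ⟨j.val - 1, by omega⟩
    else -(α * B i ⟨j.val - n - 1, by have := j.isLt; omega⟩)

/-- Sigma-point matrix `X(x̂, α, B)`: j-th column is `x̂` plus the j-th column of `Δ(α, B)`. -/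
noncomputable def sigmaPts {n : ℕ} (xhat : Fin n → ℝ) (α : ℝ)
    (B : Matrix (Fin n) (Fin n) ℝ) : Matrix (Fin n) (Fin (2*n+1)) ℝ :=
  Matrix.of fun i j => xhat i + ukfDelta n α B i j

/-- Affine propagation of an ensemble: j-th column of the result is `A·(j-th column of X) + u`. -/
noncomputable def propagate {n : ℕ} (A : Matrix (Fin n) (Fin n) ℝ) (u : Fin n → ℝ)
    (X : Matrix (Fin n) (Fin (2*n+1)) ℝ) : Matrix (Fin n) (Fin (2*n+1)) ℝ :=
  Matrix.of fun i j => A.mulVec (fun r => X r j) i + u i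

/-- Deviation matrix `X̃ = X − (X·W)·1ᵀ`. -/
noncomputable def devMat {q m : ℕ} (w : Fin m → ℝ) (X : Matrix (Fin q) (Fin m) ℝ) :
    Matrix (Fin q) (Fin m) ℝ :=
  X - Matrix.vecMulVec (X.mulVec w) (fun _ => 1)

/-- Posterior covariance as a function of the gain:
`P(K̂) = P_prior + K̂·R̄·K̂ᵀ − K̂·C·P_prior − P_prior·Cᵀ·K̂ᵀ`. -/
noncomputable def postCov {n p : ℕ} (Pprior : Matrix (Fin n) (Fin n) ℝ)
    (C : Matrix (Fin p) (Fin n) ℝ) (Rbar : Matrix (Fin p) (Fin p) ℝ)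
    (K : Matrix (Fin n) (Fin p) ℝ) : Matrix (Fin n) (Fin n) ℝ :=
  Pprior + K * Rbar * Kᵀ - K * C * Pprior - Pprior * Cᵀ * Kᵀ

theorem sum_fin_two_mul_add_one {n : ℕ} {M : Type*} [AddCommMonoid M] (f : Fin (2*n+1) → M) :
    ∑ j, f j = f 0 + (∑ i : Fin n, f ⟨i + 1, by omega⟩ + ∑ i : Fin n, f ⟨n + i + 1, by omega⟩) := by
  rw [Fin.sum_univ_succ]
  congr 1
  rw [← (finCongr (two_mul n).symm).sum_comp, Fin.sum_univ_add]
  rfl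

theorem sum_ukfW {n : ℕ} (hn : 0 < n) {α : ℝ} (hα : α ≠ 0) : ∑ j, ukfW n α j = 1 := by
  have hn' : (n : ℝ) ≠ 0 := by positivity
  rw [sum_fin_two_mul_add_one]
  simp [ukfW]
  field_simp
  ring

theorem ukfDelta_apply_zero {n : ℕ} (α : ℝ) (B : Matrix (Fin n) (Fin n) ℝ) (i : Fin n) :
    ukfDelta n α B i 0 = 0 := by
  simp [ukfDelta]

theorem ukfDelta_apply_left {n : ℕ} (α : ℝ) (B : Matrix (Fin n) (Fin n) ℝ) (i k : Fin n) :
    ukfDelta n α B i ⟨k + 1, by omega⟩ = α * B i k := by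
  have h : (k : ℕ) + 1 ≤ n := k.isLt
  simp [ukfDelta, h]

theorem ukfDelta_apply_right {n : ℕ} (α : ℝ) (B : Matrix (Fin n) (Fin n) ℝ) (i k : Fin n) :
    ukfDelta n α B i ⟨n + k + 1, by omega⟩ = -(α * B i k) := by
  have h : ¬ n + (k : ℕ) + 1 ≤ n := by omega
  have h' : n + (k : ℕ) + 1 - n - 1 = k := by omega
  simp [ukfDelta, h, h']

theorem ukfDelta_mulVec_ukfW {n : ℕ} (α : ℝ) (B : Matrix (Fin n) (Fin n) ℝ) :
    (ukfDelta n α B).mulVec (ukfW n α) = 0 := by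
  ext i
  simp only [Matrix.mulVec, dotProduct]
  rw [sum_fin_two_mul_add_one]
  simp [ukfDelta_apply_zero, ukfDelta_apply_left, ukfDelta_apply_right, ukfW]

theorem ukfDelta_mul_diagonal_ukfW_mul_transpose {n : ℕ} (hn : 0 < n) {α : ℝ} (hα : α ≠ 0)
    (B : Matrix (Fin n) (Fin n) ℝ) :
    ukfDelta n α B * Matrix.diagonal (ukfW n α) * (ukfDelta n α B)ᵀ =
      (n : ℝ)⁻¹ • (B * Bᵀ) := by
  have hn' : (n : ℝ) ≠ 0 := by positivity
  ext i k
  rw [Matrix.smul_apply, Matrix.mul_apply, Matrix.mul_apply, smul_eq_mul]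
  simp only [Matrix.mul_diagonal, Matrix.transpose_apply]
  rw [sum_fin_two_mul_add_one, Finset.mul_sum, ← Finset.sum_add_distrib]
  simp only [ukfDelta_apply_zero, ukfDelta_apply_left, ukfDelta_apply_right, ukfW, mul_zero,
    zero_add, Nat.add_eq_zero_iff, one_ne_zero, and_false, if_false]
  refine Finset.sum_congr rfl fun l _ => ?_
  field_simp
  ring

theorem propagate_sigmaPts {n : ℕ} (A : Matrix (Fin n) (Fin n) ℝ) (u xhat : Fin n → ℝ) (α : ℝ)
    (B : Matrix (Fin n) (Fin n) ℝ) :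
    propagate A u (sigmaPts xhat α B) =
      A * ukfDelta n α B + Matrix.vecMulVec (A.mulVec xhat + u) (fun _ => 1) := by
  ext i j
  simp [propagate, sigmaPts, Matrix.mulVec, dotProduct, Matrix.mul_apply, Matrix.vecMulVec_apply,
    mul_add, Finset.sum_add_distrib]
  ring

theorem devMat_add_vecMulVec {q m : ℕ} {w : Fin m → ℝ} (hw : ∑ j, w j = 1)
    {M : Matrix (Fin q) (Fin m) ℝ} (hM : M.mulVec w = 0) (c : Fin q → ℝ) :
    devMat w (M + Matrix.vecMulVec c (fun _ => 1)) = M := by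
  have hc : (Matrix.vecMulVec c (fun _ : Fin m => (1 : ℝ))).mulVec w = c := by
    ext i
    simp [Matrix.mulVec, dotProduct, Matrix.vecMulVec_apply, ← Finset.mul_sum, hw]
  rw [devMat, Matrix.add_mulVec, hM, hc, zero_add, add_sub_cancel_right]

theorem devMat_mul {q r m : ℕ} (w : Fin m → ℝ) (C : Matrix (Fin r) (Fin q) ℝ)
    (X : Matrix (Fin q) (Fin m) ℝ) : devMat w (C * X) = C * devMat w X := by
  rw [devMat, devMat, Matrix.mul_sub, Matrix.mul_vecMulVec, Matrix.mulVec_mulVec]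

theorem stmt19 {n p : ℕ} (hn : 0 < n) (hp : 0 < p)
    (A : Matrix (Fin n) (Fin n) ℝ) (C : Matrix (Fin p) (Fin n) ℝ)
    (Q P : Matrix (Fin n) (Fin n) ℝ) (R : Matrix (Fin p) (Fin p) ℝ)
    (hQ : Q.PosSemidef) (hR : R.PosDef) (hP : P.PosSemidef)
    (xhat u : Fin n → ℝ) (α : ℝ) (hα : α ≠ 0)
    (Pprior : Matrix (Fin n) (Fin n) ℝ) (hPprior : Pprior = A * P * Aᵀ + Q)
    (Rbar : Matrix (Fin p) (Fin p) ℝ) (hRbar : Rbar = C * Pprior * Cᵀ + R)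
    (B : Matrix (Fin n) (Fin n) ℝ) (hB : B * Bᵀ = (n : ℝ) • P)
    (X' : Matrix (Fin n) (Fin (2*n+1)) ℝ) (hX' : X' = propagate A u (sigmaPts xhat α B))
    (Xt : Matrix (Fin n) (Fin (2*n+1)) ℝ) (hXt : Xt = devMat (ukfW n α) X')
    (Yt : Matrix (Fin p) (Fin (2*n+1)) ℝ) (hYt : Yt = devMat (ukfW n α) (C * X'))
    (PpC : Matrix (Fin n) (Fin n) ℝ)
    (hPpC : PpC = Xt * Matrix.diagonal (ukfW n α) * Xtᵀ + Q)
    (PzC : Matrix (Fin p) (Fin p) ℝ)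
    (hPzC : PzC = Yt * Matrix.diagonal (ukfW n α) * Ytᵀ + C * Q * Cᵀ + R)
    (PezC : Matrix (Fin n) (Fin p) ℝ)
    (hPezC : PezC = Xt * Matrix.diagonal (ukfW n α) * Ytᵀ + Q * Cᵀ) :
    PezC * PzC⁻¹ = Pprior * Cᵀ * Rbar⁻¹ ∧
    PpC - PezC * PzC⁻¹ * PezCᵀ =
      Pprior - Pprior * Cᵀ * Rbar⁻¹ * C * Pprior := by
  have hn' : (n : ℝ) ≠ 0 := by positivity
  have hXt' : Xt = A * ukfDelta n α B := by
    rw [hXt, hX', propagate_sigmaPts, devMat_add_vecMulVec (sum_ukfW hn hα)]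
    rw [← Matrix.mulVec_mulVec, ukfDelta_mulVec_ukfW, Matrix.mulVec_zero]
  have hXX : Xt * Matrix.diagonal (ukfW n α) * Xtᵀ = A * P * Aᵀ := by
    have h := ukfDelta_mul_diagonal_ukfW_mul_transpose hn hα B
    rw [hB, inv_smul_smul₀ hn'] at h
    rw [hXt', Matrix.transpose_mul, ← h]
    simp only [Matrix.mul_assoc]
  have hYt' : Yt = C * Xt := by rw [hYt, hXt, devMat_mul]
  have hPp : PpC = Pprior := by rw [hPpC, hXX, hPprior]
  have hPez : PezC = Pprior * Cᵀ := by
    rw [hPezC, hYt', Matrix.transpose_mul, ← Matrix.mul_assoc, hXX, hPprior, Matrix.add_mul]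
  have hPz : PzC = Rbar := by
    rw [hPzC, hYt', hRbar, hPprior, ← hXX]
    simp only [Matrix.transpose_mul, Matrix.mul_add, Matrix.add_mul, Matrix.mul_assoc]
  have hsymm : Ppriorᵀ = Pprior := by
    have hP' : Pᵀ = P := hP.isHermitian
    have hQ' : Qᵀ = Q := hQ.isHermitian
    simp [hPprior, hP', hQ', Matrix.mul_assoc]
  rw [hPp, hPez, hPz]
  refine ⟨rfl, ?_⟩
  rw [Matrix.transpose_mul, Matrix.transpose_transpose, hsymm, ← Matrix.mul_assoc]
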